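/- Let Y : ℝ⁴ → ℝ be a harmonic polynomial homogeneous of degree 2 whose restriction to the unit sphere S³ satisfies ∫_{S³} Y² dA = 2π². Let G₁(r) = r^{-4}, G₂(r) = r^{-2}, G₃(r) = 1, G₄(r) = r², G₅(r) = r⁴, G₆(r) = r⁶, and for 1 ≤ i ≤ 6 let uᵢ(x) = Gᵢ(|x|) Y(x/|x|) on ℝ⁴ \ {0}. For r > 0 let K(r) be the symmetric 6×6 real matrix whose only nonzero entries are K₂₂ = −2r^{-6}, K₂₃ = K₃₂ = −2r^{-4}, K₂₆ = K₆₂ = 10r², K₃₃ = −3r^{-2}, K₃₅ = K₅₃ = −2r², K₅₅ = 4r⁶, K₅₆ = K₆₅ = 10r⁸, K₆₆ = 30r^{10}. Then for all 0 < τ < σ < ∞ and all 1 ≤ i, j ≤ 6, ∫_{B_σ(0)\B_τ(0)} ⟨∇Δuᵢ(x), ∇Δuⱼ(x)⟩ dx = 128 · 2π² · (K(σ) − K(τ))ᵢⱼ. -/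

import Mathlib

open scoped InnerProductSpace

noncomputable section

/-- The Euclidean Laplacian on `ℝ⁴`, `Δu = Σ_{i=1}^4 ∂²u/∂x_i²`. -/
def lap (u : EuclideanSpace ℝ (Fin 4) → ℝ) (x : EuclideanSpace ℝ (Fin 4)) : ℝ :=
  ∑ i : Fin 4,
    fderiv ℝ (fun y => fderiv ℝ u y (EuclideanSpace.single i 1)) x (EuclideanSpace.single i 1)

/-- `P : ℝ⁴ → ℝ` is a harmonic polynomial homogeneous of degree `h`. -/
def IsHarmonicHomog (h : ℕ) (P : EuclideanSpace ℝ (Fin 4) → ℝ) : Prop :=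
  (∃ p : MvPolynomial (Fin 4) ℝ, p.IsHomogeneous h ∧
    ∀ x : EuclideanSpace ℝ (Fin 4), P x = MvPolynomial.eval (fun i => x i) p) ∧
  ∀ x, lap P x = 0

/-- The radial profiles `G₁(r) = r⁻⁴, G₂ = r⁻², G₃ = 1, G₄ = r², G₅ = r⁴, G₆ = r⁶`. -/
def GG : Fin 6 → ℝ → ℝ :=
  ![fun r => (r ^ 4)⁻¹, fun r => (r ^ 2)⁻¹, fun _ => 1,
    fun r => r ^ 2, fun r => r ^ 4, fun r => r ^ 6]

/-- The symmetric matrix `K(r)` of STATEMENT 11. -/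
def Kmat (r : ℝ) : Matrix (Fin 6) (Fin 6) ℝ :=
  !![0, 0, 0, 0, 0, 0;
     0, -2 * (r ^ 6)⁻¹, -2 * (r ^ 4)⁻¹, 0, 0, 10 * r ^ 2;
     0, -2 * (r ^ 4)⁻¹, -3 * (r ^ 2)⁻¹, 0, -2 * r ^ 2, 0;
     0, 0, 0, 0, 0, 0;
     0, 0, -2 * r ^ 2, 0, 4 * r ^ 6, 10 * r ^ 8;
     0, 10 * r ^ 2, 0, 0, 10 * r ^ 8, 30 * r ^ 10]

section Homogeneous

open MeasureTheory Set Metric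

variable {E : Type*} [NormedAddCommGroup E]

/-- `H` is positively homogeneous of degree `k`. -/
def PosHomog [NormedSpace ℝ E] (k : ℕ) (H : E → ℝ) : Prop :=
  ∀ r : ℝ, 0 < r → ∀ x, H (r • x) = r ^ k * H x

namespace PosHomog

theorem mul [NormedSpace ℝ E] {k l : ℕ} {H L : E → ℝ} (hH : PosHomog k H) (hL : PosHomog l L) :
    PosHomog (k + l) (fun x => H x * L x) := fun r hr x => by
  simp only [hH r hr, hL r hr]
  ring

theorem add [NormedSpace ℝ E] {k : ℕ} {H L : E → ℝ} (hH : PosHomog k H) (hL : PosHomog k L) :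
    PosHomog k (fun x => H x + L x) := fun r hr x => by
  simp only [hH r hr, hL r hr]
  ring

theorem const_mul [NormedSpace ℝ E] {k : ℕ} {H : E → ℝ} (c : ℝ) (hH : PosHomog k H) :
    PosHomog k (fun x => c * H x) := fun r hr x => by
  simp only [hH r hr]
  ring

theorem sum [NormedSpace ℝ E] {ι : Type*} {s : Finset ι} {k : ℕ} {H : ι → E → ℝ}
    (hH : ∀ i, PosHomog k (H i)) : PosHomog k (fun x => ∑ i ∈ s, H i x) := fun r hr x => by
  simp only [fun i => hH i r hr, Finset.mul_sum]

theorem norm_sq [NormedSpace ℝ E] : PosHomog 2 (fun x : E => ‖x‖ ^ 2) := fun r hr x => by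
  simp only [norm_smul, mul_pow, Real.norm_eq_abs, sq_abs]

/-- Directional derivatives lower the degree of homogeneity by one. -/
theorem fderiv_apply [NormedSpace ℝ E] {k : ℕ} {H : E → ℝ} (hH : PosHomog (k + 1) H)
    (hd : Differentiable ℝ H) (v : E) : PosHomog k (fun x => fderiv ℝ H x v) := by
  intro r hr x
  have h1 : HasFDerivAt (fun y => H (r • y))
      ((fderiv ℝ H (r • x)).comp (r • ContinuousLinearMap.id ℝ E)) x :=
    (hd (r • x)).hasFDerivAt.comp x ((hasFDerivAt_id x).const_smul r)
  have h2 : HasFDerivAt (fun y => H (r • y)) (r ^ (k + 1) • fderiv ℝ H x) x := by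
    rw [funext (hH r hr)]
    exact (hd x).hasFDerivAt.const_mul _
  have h3 := congrArg (fun L : E →L[ℝ] ℝ => L v) (h1.unique h2)
  simp only [ContinuousLinearMap.comp_apply, smul_apply,
    ContinuousLinearMap.id_apply, map_smul, smul_eq_mul] at h3
  apply mul_left_cancel₀ hr.ne'
  rw [h3]
  ring

/-- Euler's identity. -/
theorem fderiv_self [NormedSpace ℝ E] {k : ℕ} {H : E → ℝ} (hH : PosHomog k H)
    (hd : Differentiable ℝ H) (x : E) : fderiv ℝ H x x = k * H x := by
  have h1 : HasDerivAt (fun r : ℝ => H (r • x)) (fderiv ℝ H x x) 1 := by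
    have := (hd ((1 : ℝ) • x)).hasFDerivAt.comp_hasDerivAt (1 : ℝ)
      ((hasDerivAt_id (1 : ℝ)).smul_const x)
    simpa using! this
  have h2 : HasDerivAt (fun r : ℝ => H (r • x)) (k * H x) 1 := by
    have := ((hasDerivAt_id (1 : ℝ)).pow k).mul_const (H x)
    simp only [id, one_pow, mul_one] at this
    refine this.congr_of_eventuallyEq ?_
    filter_upwards [lt_mem_nhds one_pos] with r hr using hH r hr x
  exact h1.unique h2

theorem exists_abs_le [NormedSpace ℝ E] [FiniteDimensional ℝ E] {k : ℕ} {H : E → ℝ}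
    (hH : PosHomog k H) (hc : Continuous H) : ∃ C, ∀ x ≠ 0, |H x| ≤ C * ‖x‖ ^ k := by
  obtain ⟨C, hC⟩ := (isCompact_sphere (0 : E) 1).exists_bound_of_continuousOn hc.continuousOn
  refine ⟨C, fun x hx => ?_⟩
  have hx' : 0 < ‖x‖ := norm_pos_iff.2 hx
  have h := hH ‖x‖ hx' (‖x‖⁻¹ • x)
  rw [smul_inv_smul₀ hx'.ne'] at h
  rw [h, abs_mul, abs_of_nonneg (by positivity), mul_comm]
  gcongr
  exact hC _ (by simp [norm_smul, hx'.ne'])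

variable [NormedSpace ℝ E] [FiniteDimensional ℝ E] [MeasurableSpace E] [BorelSpace E]
  (μ : Measure E) [μ.IsAddHaarMeasure]

theorem integrable_exp_neg_norm_sq_mul [Nontrivial E] {k : ℕ} {H : E → ℝ}
    (hH : PosHomog k H) (hc : Continuous H) :
    Integrable (fun x => Real.exp (-‖x‖ ^ 2) * H x) μ := by
  obtain ⟨C, hC⟩ := hH.exists_abs_le hc
  have hint : Integrable (fun x : E => Real.exp (-‖x‖ ^ 2) * ‖x‖ ^ k) μ := by
    rw [integrable_fun_norm_addHaar μ (f := fun r => Real.exp (-r ^ 2) * r ^ k)]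
    have h := integrableOn_rpow_mul_exp_neg_rpow (p := 2)
      (s := ((Module.finrank ℝ E - 1 + k : ℕ) : ℝ))
      (lt_of_lt_of_le (by norm_num) (Nat.cast_nonneg _)) (by norm_num)
    refine h.congr_fun (fun r _ => ?_) measurableSet_Ioi
    simp only [Real.rpow_natCast, Real.rpow_ofNat, smul_eq_mul, pow_add]
    ring
  refine (hint.const_mul C).mono' (by fun_prop) ?_
  have h0 : ∀ᵐ x ∂μ, x ≠ 0 := by simp [ae_iff]
  filter_upwards [h0] with x hx
  rw [norm_mul, Real.norm_eq_abs, Real.abs_exp, Real.norm_eq_abs]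
  nlinarith [hC x hx, Real.exp_pos (-‖x‖ ^ 2)]

/-- Polar coordinates for the product of a radial and a homogeneous function. -/
theorem integral_norm_mul [Nontrivial E] {k : ℕ} {H : E → ℝ} (hH : PosHomog k H) (f : ℝ → ℝ) :
    ∫ x, f ‖x‖ * H x ∂μ = (∫ y : sphere (0 : E) 1, H y ∂μ.toSphere) *
      ∫ r in Ioi (0 : ℝ), r ^ (Module.finrank ℝ E - 1) * (f r * r ^ k) :=
  calc
    ∫ x, f ‖x‖ * H x ∂μ = ∫ x : ({(0)}ᶜ : Set E), f ‖x.1‖ * H x.1 ∂(μ.comap (↑)) := by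
      rw [integral_subtype_comap (measurableSet_singleton _).compl fun x ↦ f ‖x‖ * H x,
        restrict_compl_singleton]
    _ = ∫ p : sphere (0 : E) 1 × Ioi (0 : ℝ), H p.1 * (f p.2 * p.2.1 ^ k)
          ∂μ.toSphere.prod (.volumeIoiPow (Module.finrank ℝ E - 1)) := by
      rw [← μ.measurePreserving_homeomorphUnitSphereProd.integral_comp
        (Homeomorph.measurableEmbedding _)]
      refine integral_congr_ae (.of_forall fun x => ?_)
      have hx : 0 < ‖x.1‖ := norm_pos_iff.2 x.2
      have h := hH ‖x.1‖ hx (‖x.1‖⁻¹ • x.1)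
      rw [smul_inv_smul₀ hx.ne'] at h
      simp only [homeomorphUnitSphereProd_apply_snd_coe, homeomorphUnitSphereProd_apply_fst_coe]
      rw [h]
      ring
    _ = (∫ y : sphere (0 : E) 1, H y ∂μ.toSphere) *
          ∫ r : Ioi (0 : ℝ), f r * r.1 ^ k ∂.volumeIoiPow (Module.finrank ℝ E - 1) :=
      integral_prod_mul (fun y : sphere (0 : E) 1 => H y)
        (fun r : Ioi (0 : ℝ) => f r * r.1 ^ k)
    _ = _ := by
      simp only [Measure.volumeIoiPow, ENNReal.ofReal]
      rw [integral_withDensity_eq_integral_smul,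
        integral_subtype_comap measurableSet_Ioi fun a ↦
          Real.toNNReal (a ^ (Module.finrank ℝ E - 1)) • (f a * a ^ k),
        setIntegral_congr_fun measurableSet_Ioi fun x hx ↦ ?_]
      · rw [NNReal.smul_def, Real.coe_toNNReal _ (pow_nonneg hx.out.le _), smul_eq_mul]
      · exact (measurable_subtype_coe.pow_const _).real_toNNReal

end PosHomog

end Homogeneous

section RadialPower

variable {E : Type*} [NormedAddCommGroup E] [InnerProductSpace ℝ E]

theorem hasFDerivAt_norm_sq_zpow_mul {W : E → ℝ} {x : E} (hx : x ≠ 0)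
    (hW : DifferentiableAt ℝ W x) (z : ℤ) :
    HasFDerivAt (fun y => (‖y‖ ^ 2) ^ z * W y)
      ((‖x‖ ^ 2) ^ z • fderiv ℝ W x +
        W x • ((z * (‖x‖ ^ 2) ^ (z - 1)) • (2 • innerSL ℝ x))) x := by
  have h1 : HasFDerivAt (fun y : E => ‖y‖ ^ 2) (2 • innerSL ℝ x) x :=
    (hasStrictFDerivAt_norm_sq x).hasFDerivAt
  have h2 := (hasDerivAt_zpow z (‖x‖ ^ 2) (Or.inl (by positivity))).comp_hasFDerivAt x h1
  exact h2.mul hW.hasFDerivAt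

theorem fderiv_norm_sq_zpow_mul {W : E → ℝ} {x : E} (hx : x ≠ 0)
    (hW : DifferentiableAt ℝ W x) (z : ℤ) (v : E) :
    fderiv ℝ (fun y => (‖y‖ ^ 2) ^ z * W y) x v =
      (‖x‖ ^ 2) ^ z * fderiv ℝ W x v + 2 * z * ⟪x, v⟫_ℝ * (‖x‖ ^ 2) ^ (z - 1) * W x := by
  rw [(hasFDerivAt_norm_sq_zpow_mul hx hW z).fderiv]
  simp
  ring

theorem fderiv_fderiv_norm_sq_zpow_mul {W : E → ℝ} (hW : ContDiff ℝ 2 W) {x : E} (hx : x ≠ 0)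
    (z : ℤ) (v : E) :
    fderiv ℝ (fun y => fderiv ℝ (fun y => (‖y‖ ^ 2) ^ z * W y) y v) x v =
      (‖x‖ ^ 2) ^ z * fderiv ℝ (fun y => fderiv ℝ W y v) x v
        + 4 * z * (‖x‖ ^ 2) ^ (z - 1) * (⟪x, v⟫_ℝ * fderiv ℝ W x v)
        + 2 * z * (‖x‖ ^ 2) ^ (z - 1) * ‖v‖ ^ 2 * W x
        + 4 * z * (z - 1) * (‖x‖ ^ 2) ^ (z - 2) * ⟪x, v⟫_ℝ ^ 2 * W x := by
  have hd : Differentiable ℝ W := hW.differentiable (by norm_num)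
  have hd' : Differentiable ℝ (fun y => fderiv ℝ W y v) :=
    ((hW.fderiv_right (m := 1) (by norm_num)).clm_apply contDiff_const).differentiable
      (by norm_num)
  have hL : HasFDerivAt (fun y : E => 2 * z * ⟪y, v⟫_ℝ) ((2 * z : ℝ) • innerSL ℝ v) x := by
    simp_rw [real_inner_comm]
    exact (innerSL ℝ v).hasFDerivAt.const_mul _
  have hU : HasFDerivAt (fun y : E => 2 * z * ⟪y, v⟫_ℝ * W y) _ x :=
    hL.mul (hd x).hasFDerivAt
  have heq : (fun y => fderiv ℝ (fun y => (‖y‖ ^ 2) ^ z * W y) y v) =ᶠ[nhds x]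
      (fun y => (‖y‖ ^ 2) ^ z * fderiv ℝ W y v +
        (‖y‖ ^ 2) ^ (z - 1) * (2 * z * ⟪y, v⟫_ℝ * W y)) := by
    filter_upwards [isOpen_ne.mem_nhds hx] with y hy
    rw [fderiv_norm_sq_zpow_mul hy (hd y)]
    ring
  rw [heq.fderiv_eq, fderiv_fun_add
    (hasFDerivAt_norm_sq_zpow_mul hx (hd' x) z).differentiableAt
    (hasFDerivAt_norm_sq_zpow_mul hx hU.differentiableAt (z - 1)).differentiableAt,
    add_apply, fderiv_norm_sq_zpow_mul hx (hd' x),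
    fderiv_norm_sq_zpow_mul hx hU.differentiableAt, hU.fderiv]
  simp only [add_apply, smul_apply, innerSL_apply_apply,
    smul_eq_mul, real_inner_self_eq_norm_sq, sub_sub, one_add_one_eq_two]
  push_cast
  ring

end RadialPower

section Dimension4

open MeasureTheory Set Metric

local notation "E4" => EuclideanSpace ℝ (Fin 4)

theorem sum_inner_single_mul (L : E4 →L[ℝ] ℝ) (x : E4) :
    ∑ i : Fin 4, ⟪x, EuclideanSpace.single i 1⟫_ℝ * L (EuclideanSpace.single i 1) = L x := by
  conv_rhs => rw [← (EuclideanSpace.basisFun (Fin 4) ℝ).sum_repr' x]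
  simp [real_inner_comm]

theorem sum_inner_single_sq (x : E4) :
    ∑ i : Fin 4, ⟪x, EuclideanSpace.single i 1⟫_ℝ ^ 2 = ‖x‖ ^ 2 := by
  have h := sum_inner_single_mul (innerSL ℝ x) x
  simpa only [innerSL_apply_apply, ← sq, real_inner_self_eq_norm_sq] using h

theorem inner_gradient_gradient (f g : E4 → ℝ) (x : E4) :
    ⟪gradient f x, gradient g x⟫_ℝ = ∑ i : Fin 4,
      fderiv ℝ f x (EuclideanSpace.single i 1) * fderiv ℝ g x (EuclideanSpace.single i 1) := by
  rw [← (EuclideanSpace.basisFun (Fin 4) ℝ).sum_inner_mul_inner]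
  refine Finset.sum_congr rfl fun i _ => ?_
  rw [real_inner_comm (gradient g x), inner_gradient_left, inner_gradient_left,
    EuclideanSpace.basisFun_apply]

variable {Y : E4 → ℝ}

/-- The squared length of the gradient of `Y`. -/
def gradSq (Y : E4 → ℝ) (x : E4) : ℝ :=
  ∑ i : Fin 4, fderiv ℝ Y x (EuclideanSpace.single i 1) ^ 2

theorem IsHarmonicHomog.contDiff {h : ℕ} (hY : IsHarmonicHomog h Y) {n : WithTop ℕ∞} :
    ContDiff ℝ n Y := by
  obtain ⟨⟨p, -, hp⟩, -⟩ := hY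
  rw [funext hp]
  have := AnalyticOnNhd.eval_continuousLinearMap' (𝕜 := ℝ)
    (fun i : Fin 4 => (EuclideanSpace.proj i : E4 →L[ℝ] ℝ)) p
  exact this.contDiff

theorem IsHarmonicHomog.smul {h : ℕ} (hY : IsHarmonicHomog h Y) (r : ℝ) (x : E4) :
    Y (r • x) = r ^ h * Y x := by
  obtain ⟨⟨p, hp, hpY⟩, -⟩ := hY
  rw [hpY, hpY, MvPolynomial.eval_eq, MvPolynomial.eval_eq, Finset.mul_sum]
  refine Finset.sum_congr rfl fun d hd => ?_
  have hdeg : ∑ i ∈ d.support, d i = h := by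
    rw [← hp (MvPolynomial.mem_support_iff.1 hd), Finsupp.weight_apply]
    simp [Finsupp.sum]
  simp only [PiLp.smul_apply, smul_eq_mul, mul_pow, Finset.prod_mul_distrib,
    Finset.prod_pow_eq_pow_sum, hdeg]
  ring

theorem IsHarmonicHomog.posHomog {h : ℕ} (hY : IsHarmonicHomog h Y) : PosHomog h Y :=
  fun r _ => hY.smul r

theorem IsHarmonicHomog.lap_norm_sq_zpow_mul {h : ℕ} (hY : IsHarmonicHomog h Y) {x : E4}
    (hx : x ≠ 0) (z : ℤ) :
    lap (fun y => (‖y‖ ^ 2) ^ z * Y y) x =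
      4 * z * (z + h + 1) * ((‖x‖ ^ 2) ^ (z - 1) * Y x) := by
  have h1 := sum_inner_single_mul (fderiv ℝ Y x) x
  rw [hY.posHomog.fderiv_self (hY.contDiff.differentiable one_ne_zero)] at h1
  have h2 := sum_inner_single_sq x
  have h3 := hY.2 x
  rw [lap] at h3
  have h4 : (‖x‖ ^ 2) ^ (z - 1) = (‖x‖ ^ 2) ^ (z - 2) * ‖x‖ ^ 2 := by
    rw [← zpow_add_one₀ (by positivity)]
    congr 1
    ring
  rw [lap]
  simp only [fderiv_fderiv_norm_sq_zpow_mul hY.contDiff hx, Finset.sum_add_distrib,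
    ← Finset.mul_sum, ← Finset.sum_mul, h1, h2, h3, PiLp.norm_single, norm_one,
    one_pow, Finset.sum_const, Finset.card_univ, Fintype.card_fin]
  rw [h4]
  simp
  ring

theorem IsHarmonicHomog.inner_gradient_lap {h : ℕ} (hY : IsHarmonicHomog h Y) {x : E4}
    (hx : x ≠ 0) (z w : ℤ) :
    ⟪gradient (lap fun y => (‖y‖ ^ 2) ^ z * Y y) x,
        gradient (lap fun y => (‖y‖ ^ 2) ^ w * Y y) x⟫_ℝ =
      (4 * z * (z + h + 1)) * (4 * w * (w + h + 1)) * ((‖x‖ ^ 2) ^ (z + w - 3) *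
        (‖x‖ ^ 2 * gradSq Y x
          + (2 * h * (z + w - 2) + 4 * (z - 1) * (w - 1)) * (Y x * Y x))) := by
  have hd : Differentiable ℝ Y := hY.contDiff.differentiable one_ne_zero
  have key (z : ℤ) (v : E4) : fderiv ℝ (lap fun y => (‖y‖ ^ 2) ^ z * Y y) x v =
      (4 * z * (z + h + 1) * (‖x‖ ^ 2) ^ (z - 1)) * fderiv ℝ Y x v +
        (4 * z * (z + h + 1) * (2 * (z - 1) * (‖x‖ ^ 2) ^ (z - 2) * Y x)) * ⟪x, v⟫_ℝ := by
    have heq : (lap fun y => (‖y‖ ^ 2) ^ z * Y y) =ᶠ[nhds x]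
        fun y => 4 * z * (z + h + 1) * ((‖y‖ ^ 2) ^ (z - 1) * Y y) := by
      filter_upwards [isOpen_ne.mem_nhds hx] with y hy using hY.lap_norm_sq_zpow_mul hy z
    rw [heq.fderiv_eq, fderiv_const_mul (hasFDerivAt_norm_sq_zpow_mul hx (hd x) _).differentiableAt,
      smul_apply, fderiv_norm_sq_zpow_mul hx (hd x), sub_sub, one_add_one_eq_two]
    push_cast
    rw [smul_eq_mul]
    ring
  have h1 := sum_inner_single_mul (fderiv ℝ Y x) x
  rw [hY.posHomog.fderiv_self hd] at h1
  have h2 := sum_inner_single_sq x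
  have hs : ‖x‖ ^ 2 ≠ 0 := by positivity
  have hz (z : ℤ) : (‖x‖ ^ 2) ^ (z - 1) = (‖x‖ ^ 2) ^ (z - 2) * ‖x‖ ^ 2 := by
    rw [← zpow_add_one₀ hs]
    congr 1
    ring
  have hzw : (‖x‖ ^ 2) ^ (z - 2) * (‖x‖ ^ 2) ^ (w - 2) * ‖x‖ ^ 2 = (‖x‖ ^ 2) ^ (z + w - 3) := by
    rw [← zpow_add₀ hs, ← zpow_add_one₀ hs]
    congr 1
    ring
  have expand (a b c d : ℝ) (p q : Fin 4 → ℝ) :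
      ∑ i, (a * p i + b * q i) * (c * p i + d * q i) =
        a * c * ∑ i, p i ^ 2 + (a * d + b * c) * ∑ i, q i * p i + b * d * ∑ i, q i ^ 2 := by
    simp only [Fin.sum_univ_four]
    ring
  rw [inner_gradient_gradient, ← hzw, gradSq]
  simp only [key]
  rw [expand, h1, h2, hz, hz]
  ring

theorem integral_Ioi_pow_mul_exp_neg_sq (n : ℕ) :
    ∫ r in Ioi (0 : ℝ), r ^ (2 * n + 1) * Real.exp (-r ^ 2) = n.factorial / 2 := by
  have h := integral_rpow_mul_exp_neg_rpow (p := 2) (q := ((2 * n + 1 : ℕ) : ℝ)) (by norm_num)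
    (lt_of_lt_of_le (by norm_num) (Nat.cast_nonneg _))
  simp only [Real.rpow_natCast, Real.rpow_ofNat] at h
  rw [h, show (((2 * n + 1 : ℕ) : ℝ) + 1) / 2 = n + 1 by push_cast; ring,
    Real.Gamma_nat_eq_factorial]
  ring

theorem PosHomog.integral_exp_neg_norm_sq_mul {n : ℕ} {H : E4 → ℝ} (hH : PosHomog (2 * n) H) :
    ∫ x, Real.exp (-‖x‖ ^ 2) * H x =
      (∫ y : sphere (0 : E4) 1, H y ∂(volume : Measure E4).toSphere) * ((n + 1).factorial / 2) := by
  rw [hH.integral_norm_mul volume (fun r => Real.exp (-r ^ 2)),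
    ← integral_Ioi_pow_mul_exp_neg_sq, finrank_euclideanSpace_fin]
  congr 2
  ext r
  ring

theorem IsHarmonicHomog.posHomog_gradSq (hY : IsHarmonicHomog 2 Y) : PosHomog 2 (gradSq Y) := by
  unfold gradSq
  simp only [sq]
  have h := fun i : Fin 4 => hY.posHomog.fderiv_apply
    (hY.contDiff.differentiable one_ne_zero) (EuclideanSpace.single i 1)
  exact .sum fun i => (h i).mul (h i)

theorem IsHarmonicHomog.continuous_gradSq {h : ℕ} (hY : IsHarmonicHomog h Y) :
    Continuous (gradSq Y) := by
  have h := hY.contDiff.continuous_fderiv one_ne_zero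
  unfold gradSq
  fun_prop

/-- Dirichlet energy identity for degree-two harmonics, via integration by parts against a
Gaussian weight. -/
theorem IsHarmonicHomog.integral_sphere_gradSq (hY : IsHarmonicHomog 2 Y) :
    ∫ y : sphere (0 : E4) 1, gradSq Y y ∂(volume : Measure E4).toSphere =
      12 * ∫ y : sphere (0 : E4) 1, Y y * Y y ∂(volume : Measure E4).toSphere := by
  have hd : Differentiable ℝ Y := hY.contDiff.differentiable one_ne_zero
  have hcY : Continuous Y := hd.continuous
  have hD : ContDiff ℝ 1 (fderiv ℝ Y) := hY.contDiff.fderiv_right (n := 2) (by norm_num)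
  have hDv (v : E4) : ContDiff ℝ 1 (fun x => fderiv ℝ Y x v) := hD.clm_apply contDiff_const
  have hdv (v : E4) : Differentiable ℝ (fun x => fderiv ℝ Y x v) :=
    (hDv v).differentiable one_ne_zero
  have hcv (v : E4) : Continuous (fun x => fderiv ℝ Y x v) := (hdv v).continuous
  have hcvv (v : E4) : Continuous (fun x => fderiv ℝ (fun y => fderiv ℝ Y y v) x v) := by
    have := (hDv v).continuous_fderiv one_ne_zero
    fun_prop
  have hp (v : E4) : PosHomog 1 (fun x => fderiv ℝ Y x v) := hY.posHomog.fderiv_apply hd v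
  have hpp (v : E4) : PosHomog 0 (fun x => fderiv ℝ (fun y => fderiv ℝ Y y v) x v) :=
    (hp v).fderiv_apply (hdv v) v
  have hin (v : E4) : PosHomog 1 (fun x : E4 => ⟪x, v⟫_ℝ) := fun r _ x => by
    simp only [real_inner_smul_left, pow_one]
  have hg (v x : E4) : HasFDerivAt (fun x => Real.exp (-‖x‖ ^ 2) * fderiv ℝ Y x v) _ x :=
    ((hasStrictFDerivAt_norm_sq x).hasFDerivAt.neg.exp).mul (hdv v x).hasFDerivAt
  have hgv (v x : E4) : fderiv ℝ (fun x => Real.exp (-‖x‖ ^ 2) * fderiv ℝ Y x v) x v =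
      Real.exp (-‖x‖ ^ 2) * (fderiv ℝ (fun y => fderiv ℝ Y y v) x v
        - 2 * (⟪x, v⟫_ℝ * fderiv ℝ Y x v)) := by
    rw [(hg v x).fderiv]
    simp
    ring
  have hi1 (v : E4) : Integrable (fun x => Real.exp (-‖x‖ ^ 2) *
      (fderiv ℝ Y x v * fderiv ℝ Y x v)) :=
    ((hp v).mul (hp v)).integrable_exp_neg_norm_sq_mul volume (by fun_prop)
  have hi2 (v : E4) : Integrable (fun x => Real.exp (-‖x‖ ^ 2) *
      (Y x * fderiv ℝ (fun y => fderiv ℝ Y y v) x v)) :=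
    (hY.posHomog.mul (hpp v)).integrable_exp_neg_norm_sq_mul volume (by fun_prop)
  have hi3 (v : E4) : Integrable (fun x => Real.exp (-‖x‖ ^ 2) *
      (Y x * (⟪x, v⟫_ℝ * fderiv ℝ Y x v))) :=
    (hY.posHomog.mul ((hin v).mul (hp v))).integrable_exp_neg_norm_sq_mul volume (by fun_prop)
  have hi4 (v : E4) : Integrable (fun x => Real.exp (-‖x‖ ^ 2) * (Y x * fderiv ℝ Y x v)) :=
    (hY.posHomog.mul (hp v)).integrable_exp_neg_norm_sq_mul volume (by fun_prop)
  have hi5 (v : E4) : Integrable (fun x => Y x * fderiv ℝ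
      (fun x => Real.exp (-‖x‖ ^ 2) * fderiv ℝ Y x v) x v) := by
    refine ((hi2 v).sub ((hi3 v).const_mul 2)).congr (.of_forall fun x => ?_)
    simp only [hgv, Pi.sub_apply]
    ring
  have parts (v : E4) := integral_mul_fderiv_eq_neg_fderiv_mul_of_integrable (μ := volume)
    (f := Y) (g := fun x => Real.exp (-‖x‖ ^ 2) * fderiv ℝ Y x v) (v := v)
    ((hi1 v).congr (.of_forall fun x => by ring)) (hi5 v)
    ((hi4 v).congr (.of_forall fun x => by ring)) (fun x _ => hd x)
    (fun x _ => (hg v x).differentiableAt)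
  have hL : ∫ x, ∑ i : Fin 4, Y x * fderiv ℝ (fun x => Real.exp (-‖x‖ ^ 2) *
        fderiv ℝ Y x (EuclideanSpace.single i 1)) x (EuclideanSpace.single i 1) =
      -4 * ∫ x, Real.exp (-‖x‖ ^ 2) * (Y x * Y x) := by
    rw [← integral_const_mul]
    congr 1
    ext x
    have h1 := sum_inner_single_mul (fderiv ℝ Y x) x
    rw [hY.posHomog.fderiv_self hd] at h1
    have h3 := hY.2 x
    rw [lap] at h3
    simp only [hgv, ← Finset.mul_sum, Finset.sum_sub_distrib, h1, h3]
    push_cast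
    ring
  have hR : ∫ x, ∑ i : Fin 4, fderiv ℝ Y x (EuclideanSpace.single i 1) *
        (Real.exp (-‖x‖ ^ 2) * fderiv ℝ Y x (EuclideanSpace.single i 1)) =
      ∫ x, Real.exp (-‖x‖ ^ 2) * gradSq Y x := by
    congr 1
    ext x
    rw [gradSq, Finset.mul_sum]
    exact Finset.sum_congr rfl fun i _ => by ring
  rw [integral_finsetSum _ fun i _ => hi5 _] at hL
  rw [integral_finsetSum _ fun i _ => (hi1 _).congr (.of_forall fun x => by ring)] at hR
  simp only [parts, Finset.sum_neg_distrib] at hL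
  rw [hR, PosHomog.integral_exp_neg_norm_sq_mul (n := 1) hY.posHomog_gradSq,
    PosHomog.integral_exp_neg_norm_sq_mul (n := 2) (hY.posHomog.mul hY.posHomog)] at hL
  norm_num [Nat.factorial] at hL
  linarith

theorem IsHarmonicHomog.GG_mul_eq (hY : IsHarmonicHomog 2 Y) (i : Fin 6) :
    (fun y => GG i ‖y‖ * Y (‖y‖⁻¹ • y)) = fun y => (‖y‖ ^ 2) ^ ((i : ℤ) - 3) * Y y := by
  ext y
  rw [hY.smul]
  rcases eq_or_ne y 0 with rfl | hy
  · have h0 : Y 0 = 0 := by simpa using hY.smul 0 0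
    simp [h0]
  have : ‖y‖ ≠ 0 := norm_ne_zero_iff.2 hy
  fin_cases i <;> simp [GG] <;> field_simp

theorem IsHarmonicHomog.integral_annulus (hY : IsHarmonicHomog 2 Y) {τ σ : ℝ} (hτ : 0 < τ) (hτσ : τ < σ)
    (z w : ℤ) :
    (∫ x in ball (0 : E4) σ \ ball 0 τ,
        ⟪gradient (lap fun y => (‖y‖ ^ 2) ^ z * Y y) x,
         gradient (lap fun y => (‖y‖ ^ 2) ^ w * Y y) x⟫_ℝ) =
      (4 * z * (z + 3)) * (4 * w * (w + 3)) * (4 * (z * w + 2)) *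
        (∫ y : sphere (0 : E4) 1, Y y ^ 2 ∂(volume : Measure E4).toSphere) *
        ∫ r in τ..σ, r ^ (2 * (z + w) + 1) := by
  set c : ℝ := (4 * z * (z + 3)) * (4 * w * (w + 3)) with hc
  set d : ℝ := 4 * (z + w - 2) + 4 * (z - 1) * (w - 1) with hd
  let H : E4 → ℝ := fun x => ‖x‖ ^ 2 * gradSq Y x + d * (Y x * Y x)
  have hH : PosHomog 4 H :=
    (PosHomog.norm_sq.mul hY.posHomog_gradSq).add ((hY.posHomog.mul hY.posHomog).const_mul d)
  have hcY : Continuous Y := (hY.contDiff (n := 0)).continuous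
  have hcG := hY.continuous_gradSq
  have hS : ∫ y : sphere (0 : E4) 1, H y ∂(volume : Measure E4).toSphere =
      4 * (z * w + 2) * ∫ y : sphere (0 : E4) 1, Y y ^ 2 ∂(volume : Measure E4).toSphere := by
    have hi1 : Integrable (fun y : sphere (0 : E4) 1 => gradSq Y y)
        (volume : Measure E4).toSphere :=
      (by fun_prop : Continuous _).integrable_of_hasCompactSupport (.of_compactSpace _)
    have hi2 : Integrable (fun y : sphere (0 : E4) 1 => d * (Y y * Y y))
        (volume : Measure E4).toSphere :=
      (by fun_prop : Continuous _).integrable_of_hasCompactSupport (.of_compactSpace _)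
    simp only [H, norm_eq_of_mem_sphere, one_pow, one_mul]
    rw [integral_add hi1 hi2, integral_const_mul, hY.integral_sphere_gradSq]
    simp only [← sq]
    rw [hd]
    ring
  let f : ℝ → ℝ := (Ico τ σ).indicator fun r => c * (r ^ 2) ^ (z + w - 3)
  calc
    _ = ∫ x in ball (0 : E4) σ \ ball 0 τ, c * (‖x‖ ^ 2) ^ (z + w - 3) * H x := by
      refine setIntegral_congr_fun (measurableSet_ball.diff measurableSet_ball) fun x hx => ?_
      have hx0 : x ≠ 0 := by
        rintro rfl
        exact hx.2 (mem_ball_self hτ)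
      simp only [hY.inner_gradient_lap hx0, H, hc, hd]
      push_cast
      ring
    _ = ∫ x, f ‖x‖ * H x := by
      rw [← integral_indicator (measurableSet_ball.diff measurableSet_ball)]
      congr 1
      ext x
      have : x ∈ ball (0 : E4) σ \ ball 0 τ ↔ ‖x‖ ∈ Ico τ σ := by
        simp [and_comm]
      by_cases hx : ‖x‖ ∈ Ico τ σ
      · simp only [f, indicator_of_mem hx, indicator_of_mem (this.2 hx)]
      · simp only [f, indicator_of_notMem hx, indicator_of_notMem (mt this.1 hx), zero_mul]
    _ = _ := by
      rw [hH.integral_norm_mul volume f, hS, intervalIntegral.integral_of_le hτσ.le,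
        ← integral_Ico_eq_integral_Ioc, finrank_euclideanSpace_fin]
      have : ∫ r in Ioi (0 : ℝ), r ^ (4 - 1) * (f r * r ^ 4) =
          c * ∫ r in Ico τ σ, r ^ (2 * (z + w) + 1) := by
        rw [← integral_const_mul, ← integral_indicator measurableSet_Ioi,
          ← integral_indicator measurableSet_Ico]
        congr 1
        ext r
        by_cases hr : r ∈ Ico τ σ
        · have hr0 : 0 < r := hτ.trans_le hr.1
          rw [indicator_of_mem (mem_Ioi.2 hr0), indicator_of_mem hr]
          simp only [f, indicator_of_mem hr]
          rw [← zpow_natCast r 2, ← zpow_mul, show 2 * (z + w) + 1 =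
            ((2 : ℕ) : ℤ) * (z + w - 3) + (7 : ℕ) by push_cast; ring, zpow_add₀ hr0.ne',
            zpow_natCast r 7]
          ring
        · rw [indicator_of_notMem hr]
          simp [f, indicator_of_notMem hr]
      rw [this]
      ring

end Dimension4

/-- the triharmonic bilinear forms of the basis functions
`uᵢ(x) = Gᵢ(|x|) Y(x/|x|)`, where `Y` is a degree-two spherical harmonic normalized by
`∫_{S³} Y² dA = 2π²`, over the annulus `B_σ(0) \ B_τ(0)` in `ℝ⁴`. -/
theorem stmt11 (Y : EuclideanSpace ℝ (Fin 4) → ℝ) (hY : IsHarmonicHomog 2 Y)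
    (hXnorm : (∫ y : Metric.sphere (0 : EuclideanSpace ℝ (Fin 4)) 1,
        (Y (y : EuclideanSpace ℝ (Fin 4))) ^ 2 ∂(MeasureTheory.volume.toSphere))
      = 2 * Real.pi ^ 2)
    (τ σ : ℝ) (hτ : 0 < τ) (hτσ : τ < σ) (i j : Fin 6) :
    (∫ x in Metric.ball (0 : EuclideanSpace ℝ (Fin 4)) σ \ Metric.ball 0 τ,
        ⟪gradient (lap fun y => GG i ‖y‖ * Y (‖y‖⁻¹ • y)) x,
         gradient (lap fun y => GG j ‖y‖ * Y (‖y‖⁻¹ • y)) x⟫_ℝ)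
      = 128 * (2 * Real.pi ^ 2) * (Kmat σ - Kmat τ) i j := by
  rw [hY.GG_mul_eq, hY.GG_mul_eq, hY.integral_annulus hτ hτσ, hXnorm]
  have h0 : (0 : ℝ) ∉ Set.uIcc τ σ := by
    rw [Set.uIcc_of_le hτσ.le]
    exact fun h => hτ.not_ge h.1
  have hint (n : ℤ) (hn : n ≠ -1) := integral_zpow (Or.inr ⟨hn, h0⟩)
  have hσ : σ ≠ 0 := (hτ.trans hτσ).ne'
  have hτ0 : τ ≠ 0 := hτ.ne'
  by_cases hij : (i : ℕ) + j = 5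
  · fin_cases i <;> fin_cases j <;> norm_num at hij <;> norm_num [Kmat]
  · rw [hint _ (by omega)]
    fin_cases i <;> fin_cases j <;> norm_num at hij <;> norm_num [Kmat] <;> field_simp <;> ring
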